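/- arXiv:2306.01702 — 5 statements merged into one kernel-verified Lean document; each statement's English description precedes it below -/
import Mathlib

section
/- Let P and Q be countable PO systems, W a second countable locally compact Hausdorff totally disconnected space (ω-Stone space), 𝒵 = {Z_p | p ∈ P}* a P-partition and 𝒴 = {Y_q | q ∈ Q}* a Q-partition of W, both satisfying axiom T1 (every point of W has a neighbourhood base of trim sets), and α : Q → P a map such that 𝒴 refines 𝒵 via α (i.e. Y_q ⊆ Z_{α(q)} for every q ∈ Q). Then the following are equivalent: (1) 𝒴 regularly refines 𝒵 via α (for every p ∈ P̂ and every set A that is p-trim for 𝒵, p lies in the image under α of T_𝒴(A)); (2) whenever A is r-trim for 𝒵, there exist s ∈ Q̂ and a set B that is s-trim for 𝒴 with B ⊆ A and α(s) = r; (3) for every q ∈ Q̂, every set that is q-trim for 𝒴 is α(q)-trim for 𝒵. -/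
open Set Filter Topology

universe u v

/-- A PO system: a set with a transitive antisymmetric relation `<`. -/
structure POSystem (P : Type u) : Type u where
  lt : P → P → Prop
  lt_trans : ∀ {a b c}, lt a b → lt b c → lt a c
  lt_antisymm : ∀ {a b}, lt a b → lt b a → a = b

namespace POSystem

variable {P : Type*} {Q : Type*}

/-- `a ≤ b` iff `a < b` or `a = b`. -/
def le (S : POSystem P) (a b : P) : Prop := S.lt a b ∨ a = b

theorem le_trans {S : POSystem P} {a b c : P} (h1 : S.le a b) (h2 : S.le b c) :
    S.le a c := by
  rcases h1 with h1 | rfl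
  · rcases h2 with h2 | rfl
    · exact Or.inl (S.lt_trans h1 h2)
    · exact Or.inl h1
  · exact h2

/-- A morphism of PO systems. -/
def IsMorphism (SQ : POSystem Q) (SP : POSystem P) (α : Q → P) : Prop :=
  ∀ q : Q, α '' {r | SQ.lt q r} = {p | SP.lt (α q) p}

/-- An isomorphism of PO systems. -/
def IsIso (SQ : POSystem Q) (SP : POSystem P) (β : Q → P) : Prop :=
  Function.Bijective β ∧ ∀ a b : Q, SQ.lt a b ↔ SP.lt (β a) (β b)

/-- An ideal of a PO system: a nonempty directed lower subset. -/
def IsIdeal (S : POSystem P) (J : Set P) : Prop :=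
  J.Nonempty ∧ (∀ x ∈ J, ∀ y : P, S.le y x → y ∈ J) ∧
    ∀ x ∈ J, ∀ y ∈ J, ∃ z ∈ J, S.le x z ∧ S.le y z

/-- An ideal of a subset `Qs` of a PO system. -/
def IsIdealOf (S : POSystem P) (Qs : Set P) (J : Set P) : Prop :=
  J.Nonempty ∧ J ⊆ Qs ∧ (∀ x ∈ J, ∀ y ∈ Qs, S.le y x → y ∈ J) ∧
    ∀ x ∈ J, ∀ y ∈ J, ∃ z ∈ J, S.le x z ∧ S.le y z

/-- The principal ideal `p↓`. -/
def principalIdeal (S : POSystem P) (p : P) : Set P := {q | S.le q p}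

theorem principal_isIdeal (S : POSystem P) (p : P) : IsIdeal S (principalIdeal S p) :=
  ⟨⟨p, Or.inr rfl⟩, fun _ hx y hy => le_trans hy hx,
    fun _ hx _ hy => ⟨p, Or.inr rfl, hx, hy⟩⟩

/-- `p` is the supremum of the subset `A`. -/
def IsSupOf (S : POSystem P) (p : P) (A : Set P) : Prop :=
  (∀ a ∈ A, S.le a p) ∧ ∀ q : P, (∀ a ∈ A, S.le a q) → S.le p q

/-- `p` is separated in `P` if it is not the supremum of a strictly increasing sequence. -/
def Separated (S : POSystem P) (p : P) : Prop :=
  ¬ ∃ u : ℕ → P, (∀ n, S.lt (u n) (u (n + 1)) ∧ u n ≠ u (n + 1)) ∧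
      IsSupOf S p (Set.range u)

/-- `p` is compact in `P`. -/
def CompactIn (S : POSystem P) (p : P) : Prop :=
  ∀ J : Set P, IsIdeal S J → ∀ s : P, IsSupOf S s J → S.le p s → p ∈ J

/-- The lower closure `N↓` of a subset. -/
def downSet (S : POSystem P) (N : Set P) : Set P := {p | ∃ q ∈ N, S.le p q}

/-- `N` has a finite foundation. -/
def HasFinFoundation (S : POSystem P) (N : Set P) : Prop :=
  ∃ F : Set P, F.Finite ∧ F ⊆ downSet S N ∧ ∀ r ∈ downSet S N, ∃ p ∈ F, S.le p r

def PDelta (S : POSystem P) : Set P := {p | HasFinFoundation S {p}}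

def IsLowerSubset (S : POSystem P) (L : Set P) : Prop :=
  ∀ p ∈ L, ∀ q : P, S.le q p → q ∈ L

/-- Minimal elements of `L`. -/
def minIn (S : POSystem P) (L : Set P) : Set P :=
  {p | p ∈ L ∧ ∀ q ∈ L, S.le q p → q = p}

/-- `L_min^d`: minimal elements of `L` lying in `P^d`. -/
def LminD (S : POSystem P) (L : Set P) : Set P := {p | p ∈ minIn S L ∧ ¬ S.lt p p}

/-- `(P, L, f)` is an extended PO system. -/
def IsExtPO (S : POSystem P) (L : Set P) (f : P → ℕ) : Prop :=
  IsLowerSubset S L ∧ L ⊆ PDelta S ∧ ∀ p ∈ LminD S L, 0 < f p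

/-- The order relation on the ideal completion `id(P)`: ordered by inclusion, with
`id(P)^d` the principal ideals `p↓` for `p ∈ P^d`. -/
def idLt (S : POSystem P) (J K : {J : Set P // IsIdeal S J}) : Prop :=
  (J.1 ⊆ K.1 ∧ J ≠ K) ∨ (J = K ∧ ¬ ∃ p : P, ¬ S.lt p p ∧ J.1 = principalIdeal S p)

/-- The ideal completion `id(P)` of a PO system. -/
def idPO (S : POSystem P) : POSystem {J : Set P // IsIdeal S J} where
  lt := idLt S
  lt_trans := by
    intro a b c h1 h2
    unfold idLt at h1 h2 ⊢
    rcases h1 with ⟨hab, hne⟩ | ⟨heq, h⟩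
    · rcases h2 with ⟨hbc, hne'⟩ | ⟨heq', h'⟩
      · refine Or.inl ⟨hab.trans hbc, fun hac => hne ?_⟩
        exact Subtype.ext (subset_antisymm hab (by rw [hac]; exact hbc))
      · rw [← heq']; exact Or.inl ⟨hab, hne⟩
    · rw [heq]; exact h2
  lt_antisymm := by
    intro a b h1 h2
    unfold idLt at h1 h2
    rcases h1 with ⟨hab, _⟩ | ⟨heq, _⟩
    · rcases h2 with ⟨hba, _⟩ | ⟨heq, _⟩
      · exact Subtype.ext (subset_antisymm hab hba)
      · exact heq.symm
    · exact heq

/-- The restriction of a PO system to a subset. -/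
def restrictPO (S : POSystem P) (T : Set P) : POSystem T where
  lt a b := S.lt a b
  lt_trans := fun h1 h2 => S.lt_trans h1 h2
  lt_antisymm := fun h1 h2 => Subtype.ext (S.lt_antisymm h1 h2)

end POSystem

open POSystem

section Partitions

variable {W : Type*} [TopologicalSpace W] {P : Type*} {Q : Type*}

/-- The derived set (set of limit points) of `A`. -/
def limitPts (A : Set W) : Set W := {x | x ∈ closure (A \ {x})}

/-- The type `T(A)` of a subset `A` with respect to a partition `X`. -/
def ptype (X : P → Set W) (A : Set W) : Set P := {p | (A ∩ X p).Nonempty}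

/-- A `P`-partition of `W`: pairwise disjoint nonempty sets `X p` such that
`(X p)' ∩ X = ⋃_{q < p} X q`. -/
def IsPPartition (S : POSystem P) (X : P → Set W) : Prop :=
  (∀ p, (X p).Nonempty) ∧ (Pairwise fun p q => Disjoint (X p) (X q)) ∧
    ∀ p, limitPts (X p) ∩ (⋃ q, X q) = ⋃ q ∈ {q : P | S.lt q p}, X q

/-- `A` is a `p`-trim set. -/
def IsTrimAt (S : POSystem P) (X : P → Set W) (A : Set W) (p : P) : Prop :=
  IsCompact A ∧ IsOpen A ∧ ptype X A = {q | S.le p q} ∧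
    (¬ S.lt p p → ∃! x, x ∈ A ∩ X p)

/-- `A` is a trim set. -/
def IsTrimSet (S : POSystem P) (X : P → Set W) (A : Set W) : Prop :=
  ∃ p, IsTrimAt S X A p

/-- `P̂`: the set of `p` for which some `p`-trim set exists. -/
def Phat (S : POSystem P) (X : P → Set W) : Set P := {p | ∃ A, IsTrimAt S X A p}

/-- Axiom T1: every point has a neighbourhood base of trim sets. -/
def HasTrimBases (S : POSystem P) (X : P → Set W) : Prop :=
  ∀ w : W, ∀ U ∈ nhds w, ∃ A, IsTrimSet S X A ∧ w ∈ A ∧ A ⊆ U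

/-- Axiom T2 (fullness). -/
def IsFull (S : POSystem P) (X : P → Set W) : Prop :=
  ∀ p ∈ Phat S X, ∀ w : W,
    (∀ U ∈ nhds w, ∃ A, IsTrimAt S X A p ∧ w ∈ A ∧ A ⊆ U) → w ∈ X p

/-- `w` is a clean point. -/
def IsCleanPt (S : POSystem P) (X : P → Set W) (w : W) : Prop :=
  ∃ p, w ∈ X p ∧ ∃ A, IsTrimAt S X A p ∧ w ∈ A

/-- Axiom T3: all points of `X` are clean. -/
def AllClean (S : POSystem P) (X : P → Set W) : Prop :=
  ∀ p : P, ∀ w ∈ X p, ∃ A, IsTrimAt S X A p ∧ w ∈ A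

/-- A trim `P`-partition. -/
def IsTrimPartition (S : POSystem P) (X : P → Set W) : Prop :=
  IsPPartition S X ∧ HasTrimBases S X ∧ IsFull S X ∧ AllClean S X

/-- A complete partition: the blocks cover `W`. -/
def IsCompletePartition (X : P → Set W) : Prop := (⋃ p, X p) = Set.univ

/-- `Y` refines `Z` via `α`. -/
def Refines (Y : Q → Set W) (Z : P → Set W) (α : Q → P) : Prop :=
  ∀ q, Y q ⊆ Z (α q)

/-- `Y` regularly refines `Z` via `α` (`Z` regularly consolidates `Y` via `α`). -/
def RegRefines (SQ : POSystem Q) (SP : POSystem P) (Y : Q → Set W) (Z : P → Set W)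
    (α : Q → P) : Prop :=
  Refines Y Z α ∧ ∀ p ∈ Phat SP Z, ∀ A : Set W, IsTrimAt SP Z A p → p ∈ α '' ptype Y A

/-- A semi-trim partition: T1, T2, and clean points are dense in each `X p`, `p ∈ P̂`. -/
def IsSemiTrim (S : POSystem P) (X : P → Set W) : Prop :=
  IsPPartition S X ∧ HasTrimBases S X ∧ IsFull S X ∧
    ∀ p ∈ Phat S X, X p ⊆ closure {w | w ∈ X p ∧ ∃ A, IsTrimAt S X A p ∧ w ∈ A}

/-- A strongly semi-trim partition: T1, T2, and all points of `X p` are clean, `p ∈ P̂`. -/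
def IsStronglySemiTrim (S : POSystem P) (X : P → Set W) : Prop :=
  IsPPartition S X ∧ HasTrimBases S X ∧ IsFull S X ∧
    ∀ p ∈ Phat S X, ∀ w ∈ X p, ∃ A, IsTrimAt S X A p ∧ w ∈ A

/-- The labels of a sequence are pairwise strictly incomparable or strictly increasing. -/
def PairwiseIncompOrStrictIncr (S : POSystem P) (τ : ℕ → P) : Prop :=
  (∀ j k, j ≠ k → ¬ S.le (τ j) (τ k)) ∨ (∀ j k, j < k → S.lt (τ j) (τ k) ∧ τ j ≠ τ k)

/-- A rank `P`-partition: a complete `P`-partition satisfying RP1 and RP2. -/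
def IsRankPartition (S : POSystem P) (X : P → Set W) : Prop :=
  IsPPartition S X ∧ IsCompletePartition X ∧
    (∀ q : P, Separated S q → ∀ (x : W) (u : ℕ → W) (τx : P) (τu : ℕ → P),
      x ∈ X τx → (∀ k, u k ∈ X (τu k)) →
      Filter.Tendsto u Filter.atTop (nhds x) → (∀ k, u k ≠ x) →
      S.le q τx → PairwiseIncompOrStrictIncr S τu →
      ∀ᶠ k in Filter.atTop, S.le q (τu k)) ∧
    (∀ (x : W) (τx : P), x ∈ X τx → ¬ Separated S τx →
      ∃ u : ℕ → W, Filter.Tendsto u Filter.atTop (nhds x) ∧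
        ∀ k, ∃ q, u k ∈ X q ∧ S.lt q τx ∧ q ≠ τx)

/-- `I_w`: the set of types of trim neighbourhoods of `w`. -/
def Iw (S : POSystem P) (X : P → Set W) (w : W) : Set P :=
  {p | ∃ A : Set W, IsTrimAt S X A p ∧ w ∈ A}

/-- A trim `(P, L, f)`-partition. -/
def IsTrimPLF (S : POSystem P) (L : Set P) (f : P → ℕ) (Z : P → Set W) : Prop :=
  IsTrimPartition S Z ∧ (∀ p, IsCompact (closure (Z p)) ↔ p ∈ L) ∧
    ∀ p ∈ LminD S L, Nat.card (Z p) = f p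

/-- A bounded trim `(P, L, f)`-partition. -/
def IsBoundedTrimPLF (S : POSystem P) (L : Set P) (f : P → ℕ) (Z : P → Set W) : Prop :=
  IsTrimPLF S L f Z ∧ IsCompact (closure (⋃ p ∈ L, Z p))

end Partitions

section Primitive

variable {W : Type*} [TopologicalSpace W]

/-- The ideal `(A)` of compact open subsets of `A`. -/
def coIdeal (A : Set W) : Set (Set W) := {C | IsCompact C ∧ IsOpen C ∧ C ⊆ A}

/-- `(A) ≅ (B)` as Boolean rings (equivalently, as posets). -/
def IdealIso (A B : Set W) : Prop := Nonempty (↥(coIdeal A) ≃o ↥(coIdeal B))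

/-- `(A) × (B) ≅ (A)`. -/
def ProdIdealIso (A B : Set W) : Prop :=
  Nonempty ((↥(coIdeal A) × ↥(coIdeal B)) ≃o ↥(coIdeal A))

/-- A compact open `A` is pseudo-indecomposable (PI). -/
def IsPISet (A : Set W) : Prop :=
  IsCompact A ∧ IsOpen A ∧ ∀ B : Set W, IsCompact B → IsOpen B → B ⊆ A →
    IdealIso B A ∨ IdealIso (A \ B) A

/-- `W` is primitive: every compact open set is a finite disjoint union of PI sets. -/
def PrimitiveSpace (W : Type*) [TopologicalSpace W] : Prop :=
  ∀ A : Set W, IsCompact A → IsOpen A →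
    ∃ (n : ℕ) (F : Fin n → Set W), (∀ i, IsPISet (F i)) ∧
      (Pairwise fun i j => Disjoint (F i) (F j)) ∧ A = ⋃ i, F i

/-- The setoid of PI compact opens up to isomorphism of their ideals. -/
def piIsoSetoid (W : Type*) [TopologicalSpace W] : Setoid {A : Set W // IsPISet A} where
  r A B := IdealIso A.1 B.1
  iseqv := ⟨fun _ => ⟨OrderIso.refl _⟩,
    fun h => h.elim fun e => ⟨e.symm⟩,
    fun h1 h2 => h1.elim fun e => h2.elim fun f => ⟨e.trans f⟩⟩

/-- The underlying set of the structure diagram `𝒮(W)`: isomorphism classes of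
PI compact open subsets of `W`. -/
def SDiagram (W : Type*) [TopologicalSpace W] : Type _ := Quotient (piIsoSetoid W)

/-- The relation on `𝒮(W)`: `[A] < [B]` iff `(A) × (B) ≅ (A)`. -/
def SDiagramLt {W : Type*} [TopologicalSpace W] (x y : SDiagram W) : Prop :=
  ∃ A B : {A : Set W // IsPISet A}, x = Quotient.mk (piIsoSetoid W) A ∧
    y = Quotient.mk (piIsoSetoid W) B ∧ ProdIdealIso A.1 B.1

/-- The blocks of the canonical partition `𝒳(W)`: points having a neighbourhood base
of compact open sets of class `p`. -/
def canonicalBlock {W : Type*} [TopologicalSpace W] (p : SDiagram W) : Set W :=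
  {w | ∀ U ∈ nhds w, ∃ A : {A : Set W // IsPISet A},
      Quotient.mk (piIsoSetoid W) A = p ∧ w ∈ A.1 ∧ A.1 ⊆ U}

/-- The setoid of points of `W` under the homeomorphism group. -/
def homeoSetoid (W : Type*) [TopologicalSpace W] : Setoid W where
  r w x := ∃ h : W ≃ₜ W, h w = x
  iseqv := ⟨fun w => ⟨Homeomorph.refl W, rfl⟩,
    fun h => h.elim fun e he => ⟨e.symm, by rw [← he, Homeomorph.symm_apply_apply]⟩,
    fun h1 h2 => h1.elim fun e he => h2.elim fun f hf =>
      ⟨e.trans f, by rw [Homeomorph.trans_apply, he, hf]⟩⟩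

end Primitive

theorem aux_subset_limit {W : Type*} [TopologicalSpace W] {P : Type*} {S : POSystem P}
    {X : P → Set W} (h : IsPPartition S X) {a b : P} (hab : S.lt a b) :
    X a ⊆ limitPts (X b) := by
  intro x hx
  have : x ∈ ⋃ q ∈ {q : P | S.lt q b}, X q := by
    simp only [mem_iUnion]
    exact ⟨a, hab, hx⟩
  rw [← h.2.2 b] at this
  exact this.1

theorem aux_block_eq {W : Type*} [TopologicalSpace W] {P : Type*} {S : POSystem P}
    {X : P → Set W} (h : IsPPartition S X) {a b : P} {x : W} (ha : x ∈ X a) (hb : x ∈ X b) :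
    a = b := by
  by_contra hne
  exact Set.disjoint_left.1 (h.2.1 hne) ha hb

theorem aux_lt_of_limit {W : Type*} [TopologicalSpace W] {P : Type*} {S : POSystem P}
    {X : P → Set W} (h : IsPPartition S X) {a b : P} {x : W} (ha : x ∈ X a)
    (hx : x ∈ limitPts (X b)) : S.lt a b := by
  have : x ∈ limitPts (X b) ∩ ⋃ q, X q := ⟨hx, mem_iUnion.2 ⟨a, ha⟩⟩
  rw [h.2.2 b] at this
  simp only [mem_iUnion] at this
  obtain ⟨c, hc, hxc⟩ := this
  rw [aux_block_eq h ha hxc]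
  exact hc

theorem aux_le_antisymm {P : Type*} {S : POSystem P} {a b : P} (h1 : S.le a b)
    (h2 : S.le b a) : a = b := by
  rcases h1 with h1 | h1
  · rcases h2 with h2 | h2
    · exact S.lt_antisymm h1 h2
    · exact h2.symm
  · exact h1

theorem aux_alpha_lt {W : Type*} [TopologicalSpace W] {P : Type*} {Q : Type*}
    {SP : POSystem P} {SQ : POSystem Q} {Z : P → Set W} {Y : Q → Set W}
    (hZ : IsPPartition SP Z) (hY : IsPPartition SQ Y) {α : Q → P} (href : Refines Y Z α)
    {a b : Q} (hab : SQ.lt a b) : SP.lt (α a) (α b) := by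
  obtain ⟨x, hx⟩ := hY.1 a
  refine aux_lt_of_limit hZ (href a hx) ?_
  exact closure_mono (diff_subset_diff_left (href b)) (aux_subset_limit hY hab hx)

theorem aux_alpha_le {W : Type*} [TopologicalSpace W] {P : Type*} {Q : Type*}
    {SP : POSystem P} {SQ : POSystem Q} {Z : P → Set W} {Y : Q → Set W}
    (hZ : IsPPartition SP Z) (hY : IsPPartition SQ Y) {α : Q → P} (href : Refines Y Z α)
    {a b : Q} (hab : SQ.le a b) : SP.le (α a) (α b) := by
  rcases hab with h | rfl
  · exact Or.inl (aux_alpha_lt hZ hY href h)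
  · exact Or.inr rfl

theorem aux_mem {W : Type*} [TopologicalSpace W] {P : Type*} {S : POSystem P}
    {X : P → Set W} {A : Set W} {p : P} (h : IsTrimAt S X A p) : ∃ x ∈ A, x ∈ X p := by
  have : p ∈ ptype X A := by rw [h.2.2.1]; exact Or.inr rfl
  exact this

theorem aux_le {W : Type*} [TopologicalSpace W] {P : Type*} {S : POSystem P}
    {X : P → Set W} {A : Set W} {p q : P} {x : W} (h : IsTrimAt S X A p) (hx : x ∈ A)
    (hq : x ∈ X q) : S.le p q := by
  have : q ∈ ptype X A := ⟨x, hx, hq⟩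
  rwa [h.2.2.1] at this

/-- Proposition on regular refinements (Prop. regref). -/
theorem regular_refinement_tfae {P : Type u} {Q : Type v} {W : Type*}
    [Countable P] [Countable Q]
    [TopologicalSpace W] [SecondCountableTopology W] [LocallyCompactSpace W]
    [T2Space W] [TotallyDisconnectedSpace W]
    (SP : POSystem P) (SQ : POSystem Q) (Z : P → Set W) (Y : Q → Set W)
    (hZ : IsPPartition SP Z) (hY : IsPPartition SQ Y)
    (hZ1 : HasTrimBases SP Z) (hY1 : HasTrimBases SQ Y)
    (α : Q → P) (href : Refines Y Z α) :
    List.TFAE [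
      RegRefines SQ SP Y Z α,
      ∀ (r : P) (A : Set W), IsTrimAt SP Z A r →
        ∃ s ∈ Phat SQ Y, ∃ B : Set W, IsTrimAt SQ Y B s ∧ B ⊆ A ∧ α s = r,
      ∀ q ∈ Phat SQ Y, ∀ A : Set W, IsTrimAt SQ Y A q → IsTrimAt SP Z A (α q)] := by
  tfae_have 1 → 2 := by
    intro h r A hA
    obtain ⟨q, ⟨w, hwA, hwq⟩, rfl⟩ := h.2 r ⟨A, hA⟩ A hA
    obtain ⟨B, ⟨s, hB⟩, hwB, hBA⟩ := hY1 w A (hA.2.1.mem_nhds hwA)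
    obtain ⟨x, hxB, hxs⟩ := aux_mem hB
    refine ⟨s, ⟨B, hB⟩, B, hB, hBA, ?_⟩
    exact aux_le_antisymm (aux_alpha_le hZ hY href (aux_le hB hwB hwq))
      (aux_le hA (hBA hxB) (href s hxs))
  tfae_have 2 → 1 := by
    intro h
    refine ⟨href, fun p _ A hA => ?_⟩
    obtain ⟨s, _, B, hB, hBA, hs⟩ := h p A hA
    obtain ⟨x, hxB, hxs⟩ := aux_mem hB
    exact ⟨s, ⟨x, hBA hxB, hxs⟩, hs⟩
  tfae_have 3 → 1 := by
    intro h
    refine ⟨href, fun p _ A hA => ?_⟩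
    obtain ⟨w, hwA, hwp⟩ := aux_mem hA
    obtain ⟨B, ⟨s, hB⟩, hwB, hBA⟩ := hY1 w A (hA.2.1.mem_nhds hwA)
    obtain ⟨x, hxB, hxs⟩ := aux_mem hB
    exact ⟨s, ⟨x, hBA hxB, hxs⟩, aux_le_antisymm (aux_le (h s ⟨B, hB⟩ B hB) hwB hwp)
      (aux_le hA (hBA hxB) (href s hxs))⟩
  tfae_have 1 → 3 := by
    intro h q _ A hA
    obtain ⟨x, hxA, hxq⟩ := aux_mem hA
    have key : ∀ (p : P) (w : W) (U : Set W), IsOpen U → U ⊆ A → w ∈ U → w ∈ Z p →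
        ∃ t y, y ∈ U ∧ y ∈ Y t ∧ SQ.le q t ∧ SP.le (α t) p := by
      intro p w U hU hUA hwU hwp
      obtain ⟨B, ⟨r, hB⟩, hwB, hBU⟩ := hZ1 w U (hU.mem_nhds hwU)
      obtain ⟨t, ⟨y, hyB, hyt⟩, rfl⟩ := h.2 r ⟨B, hB⟩ B hB
      exact ⟨t, y, hBU hyB, hyt, aux_le hA (hUA (hBU hyB)) hyt, aux_le hB hwB hwp⟩
    refine ⟨hA.1, hA.2.1, ?_, ?_⟩
    · ext p
      constructor
      · rintro ⟨w, hwA, hwp⟩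
        obtain ⟨t, y, _, _, hqt, htp⟩ := key p w A hA.2.1 subset_rfl hwA hwp
        exact POSystem.le_trans (aux_alpha_le hZ hY href hqt) htp
      · rintro (hp | rfl)
        · have hx : x ∈ closure (Z p \ {x}) := aux_subset_limit hZ hp (href q hxq)
          obtain ⟨y, hyA, hyZ, _⟩ := mem_closure_iff.1 hx A hA.2.1 hxA
          exact ⟨y, hyA, hyZ⟩
        · exact ⟨x, hxA, href q hxq⟩
    · intro hd
      have hqd : ¬ SQ.lt q q := fun hq => hd (aux_alpha_lt hZ hY href hq)
      refine ⟨x, ⟨hxA, href q hxq⟩, ?_⟩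
      rintro w ⟨hwA, hwZ⟩
      by_contra hne
      obtain ⟨t, y, ⟨hyA, hyx⟩, hyt, hqt, htp⟩ := key (α q) w (A \ {x})
        (hA.2.1.sdiff isClosed_singleton) diff_subset ⟨hwA, hne⟩ hwZ
      rcases hqt with hlt | rfl
      · have h1 := aux_alpha_lt hZ hY href hlt
        rcases htp with h2 | h2
        · exact hd (SP.lt_trans h1 h2)
        · rw [h2] at h1
          exact hd h1
      · exact hyx ((hA.2.2.2 hqd).unique ⟨hyA, hyt⟩ ⟨hxA, hxq⟩)
  tfae_finish
end

section
/- Let P and Q be countable PO systems, α : Q → P a map, 𝒴 a trim Q-partition and 𝒵 a trim P-partition of the ω-Stone space W. If 𝒴 regularly refines 𝒵 via α, then α is a surjective morphism of PO systems. -/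
open Set Filter Topology

universe u v

open POSystem

/-- if `𝒴` regularly refines `𝒵` via `α` then `α` is a surjective morphism. -/
theorem regRefines_surjective_morphism {P : Type u} {Q : Type v} {W : Type*}
    [Countable P] [Countable Q]
    [TopologicalSpace W] [SecondCountableTopology W] [LocallyCompactSpace W]
    [T2Space W] [TotallyDisconnectedSpace W]
    (SP : POSystem P) (SQ : POSystem Q) (α : Q → P)
    (Y : Q → Set W) (Z : P → Set W)
    (hY : IsTrimPartition SQ Y) (hZ : IsTrimPartition SP Z)
    (h : RegRefines SQ SP Y Z α) :
    Function.Surjective α ∧ POSystem.IsMorphism SQ SP α := by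
  obtain ⟨⟨hYne, hYd, hYl⟩, hY1, hY2, hY3⟩ := hY
  obtain ⟨⟨hZne, hZd, hZl⟩, hZ1, hZ2, hZ3⟩ := hZ
  obtain ⟨href, hreg⟩ := h
  have huniq : ∀ {x : W} {a b : P}, x ∈ Z a → x ∈ Z b → a = b := by
    intro x a b ha hb
    by_contra hne
    exact Set.disjoint_left.1 (hZd hne) ha hb
  refine ⟨?_, ?_⟩
  · intro p
    obtain ⟨z, hz⟩ := hZne p
    obtain ⟨A, hA, _⟩ := hZ3 p z hz
    obtain ⟨q, _, hq⟩ := hreg p ⟨A, hA⟩ A hA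
    exact ⟨q, hq⟩
  · intro q
    obtain ⟨x, hx⟩ := hYne q
    apply Set.Subset.antisymm
    · rintro _ ⟨r, hr, rfl⟩
      have hr' : SQ.lt q r := hr
      have h1 : x ∈ limitPts (Y r) ∩ ⋃ q, Y q := by
        rw [hYl r]
        exact Set.mem_biUnion hr' hx
      have h2 : x ∈ limitPts (Z (α r)) ∩ ⋃ p, Z p :=
        ⟨closure_mono (Set.diff_subset_diff_left (href r)) h1.1,
          Set.mem_iUnion.2 ⟨α q, href q hx⟩⟩
      rw [hZl] at h2
      obtain ⟨p, hp, hxp⟩ := Set.mem_iUnion₂.1 h2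
      have := huniq hxp (href q hx)
      subst this
      exact hp
    · intro p hp
      have hp' : SP.lt (α q) p := hp
      obtain ⟨A, ⟨_, hAo, hAt, hAu⟩, hxA⟩ := hY3 q x hx
      have h1 : x ∈ limitPts (Z p) ∩ ⋃ p, Z p := by
        rw [hZl p]
        exact Set.mem_biUnion hp' (href q hx)
      obtain ⟨z, hzA, hzZ, hzx⟩ := mem_closure_iff.1 h1.1 A hAo hxA
      obtain ⟨B, hB, hzB⟩ := hZ3 p z hzZ
      have hU : B ∩ (A ∩ {x}ᶜ) ∈ nhds z :=
        (hB.2.1.inter (hAo.inter isOpen_compl_singleton)).mem_nhds ⟨hzB, hzA, hzx⟩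
      obtain ⟨C, ⟨s, hC⟩, hzC, hCU⟩ := hZ1 z _ hU
      have hsp : SP.le s p := by
        have : p ∈ ptype Z C := ⟨z, hzC, hzZ⟩
        rw [hC.2.2.1] at this
        exact this
      have hps : SP.le p s := by
        have h3 : s ∈ ptype Z C := by
          rw [hC.2.2.1]
          exact Or.inr rfl
        obtain ⟨w, hwC, hws⟩ := h3
        have : s ∈ ptype Z B := ⟨w, (hCU hwC).1, hws⟩
        rw [hB.2.2.1] at this
        exact this
      have hs : s = p := by
        rcases hsp with hsp | hsp
        · rcases hps with hps | hps
          · exact SP.lt_antisymm hsp hps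
          · exact hps.symm
        · exact hsp
      subst hs
      obtain ⟨r, ⟨w, hwC, hwr⟩, hr⟩ := hreg s ⟨C, hC⟩ C hC
      refine ⟨r, ?_, hr⟩
      have hqr : r ∈ ptype Y A := ⟨w, (hCU hwC).2.1, hwr⟩
      rw [hAt] at hqr
      rcases hqr with hqr | rfl
      · exact hqr
      · by_contra hn
        exact (hCU hwC).2.2 ((hAu hn).unique ⟨(hCU hwC).2.1, hwr⟩ ⟨hxA, hx⟩)
end

section
/- Let Q be a countable PO system and 𝒴 a trim Q-partition of the primitive ω-Stone space W. Then the assignment (P, α) ↦ 𝒴α (the unique trim P-partition with 𝒴 ≺_α 𝒴α) induces a one-to-one correspondence between equivalence classes of Q-pairs (P, α), where α : Q → P is a surjective morphism, and trim partitions of W that regularly consolidate 𝒴. -/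
open Set Filter Topology

universe u v

open POSystem

section Helpers

variable {W : Type*} [TopologicalSpace W] {P : Type*} {Q : Type*}

theorem hlp_le_antisymm {S : POSystem P} {a b : P} (h1 : S.le a b) (h2 : S.le b a) : a = b := by
  rcases h1 with h1 | h1
  · rcases h2 with h2 | h2
    · exact S.lt_antisymm h1 h2
    · exact h2.symm
  · exact h1

/-- if `w` lies in the block of `p` and in a `q`-trim set then `q ≤ p`. -/
theorem hlp_le_of_mem {S : POSystem P} {X : P → Set W} {A : Set W} {q p : P} {w : W}
    (hA : IsTrimAt S X A q) (hwA : w ∈ A) (hw : w ∈ X p) : S.le q p := by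
  have : p ∈ ptype X A := ⟨w, hwA, hw⟩
  rw [hA.2.2.1] at this
  exact this

theorem hlp_exists {S : POSystem P} {X : P → Set W} {A : Set W} {q p : P}
    (hA : IsTrimAt S X A q) (h : S.le q p) : ∃ w, w ∈ A ∧ w ∈ X p := by
  have : p ∈ ptype X A := by rw [hA.2.2.1]; exact h
  exact this

theorem hlp_nhds {S : POSystem P} {X : P → Set W} {A : Set W} {q : P} {w : W}
    (hA : IsTrimAt S X A q) (hwA : w ∈ A) : A ∈ nhds w := hA.2.1.mem_nhds hwA

theorem hlp_disj {S : POSystem P} {X : P → Set W} (h : IsTrimPartition S X) {p q : P} {w : W}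
    (h1 : w ∈ X p) (h2 : w ∈ X q) : p = q := by
  by_contra hne
  exact Set.disjoint_left.1 (h.1.2.1 hne) h1 h2

theorem hlp_base {S : POSystem P} {X : P → Set W} (h : IsTrimPartition S X) {p : P} {w : W}
    (hw : w ∈ X p) {U : Set W} (hU : U ∈ nhds w) : ∃ A, IsTrimAt S X A p ∧ w ∈ A ∧ A ⊆ U := by
  obtain ⟨A, hA, hwA⟩ := h.2.2.2 p w hw
  obtain ⟨B, ⟨q, hB⟩, hwB, hBU⟩ := h.2.1 w (U ∩ A) (inter_mem hU (hlp_nhds hA hwA))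
  have h1 : S.le q p := hlp_le_of_mem hB hwB hw
  obtain ⟨x, hxB, hxq⟩ := hlp_exists hB (Or.inr rfl)
  have h2 : S.le p q := hlp_le_of_mem hA (hBU hxB).2 hxq
  obtain rfl := hlp_le_antisymm h1 h2
  exact ⟨B, hB, hwB, fun x hx => (hBU hx).1⟩

theorem hlp_limit {S : POSystem P} {X : P → Set W} (h : IsTrimPartition S X) {p q : P} {w : W}
    (hw : w ∈ X q) : w ∈ limitPts (X p) ↔ S.lt q p := by
  have h3 := h.1.2.2 p
  constructor
  · intro hl
    have : w ∈ limitPts (X p) ∩ ⋃ q, X q := ⟨hl, mem_iUnion.2 ⟨q, hw⟩⟩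
    rw [h3] at this
    obtain ⟨r, hr, hwr⟩ := mem_iUnion₂.1 this
    rw [hlp_disj h hw hwr]
    exact hr
  · intro hl
    have : w ∈ ⋃ q ∈ {q : P | S.lt q p}, X q := mem_iUnion₂.2 ⟨q, hl, hw⟩
    rw [← h3] at this
    exact this.1

theorem hlp_mem_limit {X : Set W} {w : W} :
    w ∈ limitPts X ↔ ∀ U ∈ nhds w, ∃ x ∈ U, x ∈ X ∧ x ≠ w := by
  unfold limitPts
  rw [mem_setOf_eq, mem_closure_iff_nhds]
  constructor
  · intro h U hU
    obtain ⟨x, hx, hx2, hx3⟩ := h U hU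
    exact ⟨x, hx, hx2, hx3⟩
  · intro h U hU
    obtain ⟨x, hx, hx2, hx3⟩ := h U hU
    exact ⟨x, hx, hx2, hx3⟩

/-- The consolidated partition. -/
def consol (SQ : POSystem Q) (SP : POSystem P) (Y : Q → Set W) (α : Q → P) (p : P) : Set W :=
  {w | (∃ q ∈ Iw SQ Y w, α q = p) ∧ ∀ q ∈ Iw SQ Y w, SP.le (α q) p}

theorem hlp_mor_le {SQ : POSystem Q} {SP : POSystem P} {α : Q → P}
    (hα : IsMorphism SQ SP α) {q r : Q} (h : SQ.le q r) : SP.le (α q) (α r) := by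
  rcases h with h | rfl
  · left
    have : α r ∈ α '' {r | SQ.lt q r} := ⟨r, h, rfl⟩
    rw [hα q] at this
    exact this
  · right; rfl

theorem hlp_mor_lt {SQ : POSystem Q} {SP : POSystem P} {α : Q → P}
    (hα : IsMorphism SQ SP α) {q r : Q} (h : SQ.lt q r) : SP.lt (α q) (α r) := by
  have : α r ∈ α '' {r | SQ.lt q r} := ⟨r, h, rfl⟩
  rw [hα q] at this
  exact this

theorem hlp_mor_ex {SQ : POSystem Q} {SP : POSystem P} {α : Q → P}
    (hα : IsMorphism SQ SP α) {q : Q} {p : P} (h : SP.lt (α q) p) : ∃ r, SQ.lt q r ∧ α r = p := by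
  have : p ∈ {p | SP.lt (α q) p} := h
  rw [← hα q] at this
  exact this

theorem hlp_consol_sub {SQ : POSystem Q} {SP : POSystem P} {Y : Q → Set W} {α : Q → P}
    (hY : IsTrimPartition SQ Y) (hα : IsMorphism SQ SP α) {q : Q} {w : W} (hw : w ∈ Y q) :
    w ∈ consol SQ SP Y α (α q) := by
  obtain ⟨A, hA, hwA⟩ := hY.2.2.2 q w hw
  refine ⟨⟨q, ⟨A, hA, hwA⟩, rfl⟩, ?_⟩
  rintro r ⟨B, hB, hwB⟩
  exact hlp_mor_le hα (hlp_le_of_mem hB hwB hw)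

theorem hlp_consol_disj {SQ : POSystem Q} {SP : POSystem P} {Y : Q → Set W} {α : Q → P}
    {p r : P} {w : W} (hp : w ∈ consol SQ SP Y α p) (hr : w ∈ consol SQ SP Y α r) : p = r := by
  obtain ⟨⟨q, hq, rfl⟩, h1⟩ := hp
  obtain ⟨⟨q', hq', rfl⟩, h2⟩ := hr
  exact hlp_le_antisymm (h2 q hq) (h1 q' hq')

theorem hlp_consol_base {SQ : POSystem Q} {SP : POSystem P} {Y : Q → Set W} {α : Q → P}
    (hY : IsTrimPartition SQ Y) (hα : IsMorphism SQ SP α) {p : P} {w : W}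
    (hw : w ∈ consol SQ SP Y α p) {U : Set W} (hU : U ∈ nhds w) :
    ∃ q A, IsTrimAt SQ Y A q ∧ w ∈ A ∧ A ⊆ U ∧ α q = p := by
  obtain ⟨⟨q, ⟨A, hA, hwA⟩, rfl⟩, h1⟩ := hw
  obtain ⟨B, ⟨r, hB⟩, hwB, hBU⟩ := hY.2.1 w (U ∩ A) (inter_mem hU (hlp_nhds hA hwA))
  obtain ⟨x, hxB, hxr⟩ := hlp_exists hB (Or.inr rfl)
  exact ⟨r, B, hB, hwB, fun x hx => (hBU hx).1,
    hlp_le_antisymm (h1 r ⟨B, hB, hwB⟩) (hlp_mor_le hα (hlp_le_of_mem hA (hBU hxB).2 hxr))⟩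

theorem hlp_trim_consol {SQ : POSystem Q} {SP : POSystem P} {Y : Q → Set W} {α : Q → P}
    [T2Space W] (hY : IsTrimPartition SQ Y) (hα : IsMorphism SQ SP α) {q : Q} {A : Set W}
    (hA : IsTrimAt SQ Y A q) : IsTrimAt SP (consol SQ SP Y α) A (α q) := by
  refine ⟨hA.1, hA.2.1, ?_, ?_⟩
  · ext p
    constructor
    · rintro ⟨w, hwA, hw⟩
      exact hw.2 q ⟨A, hA, hwA⟩
    · intro h
      have : ∃ r, SQ.le q r ∧ α r = p := by
        rcases h with h | h
        · obtain ⟨r, hr, hr'⟩ := hlp_mor_ex hα h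
          exact ⟨r, Or.inl hr, hr'⟩
        · exact ⟨q, Or.inr rfl, h⟩
      obtain ⟨r, hr, rfl⟩ := this
      obtain ⟨w, hwA, hw⟩ := hlp_exists hA hr
      exact ⟨w, hwA, hlp_consol_sub hY hα hw⟩
  · intro hp
    obtain ⟨y, ⟨hyA, hyq⟩, hu⟩ := hA.2.2.2 (fun h => hp (hlp_mor_lt hα h))
    refine ⟨y, ⟨hyA, hlp_consol_sub hY hα hyq⟩, ?_⟩
    rintro w ⟨hwA, hw⟩
    by_contra hne
    have hU : A ∩ {y}ᶜ ∈ nhds w :=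
      inter_mem (hlp_nhds hA hwA) (isOpen_compl_singleton.mem_nhds hne)
    obtain ⟨r, B, hB, hwB, hBU, hr⟩ := hlp_consol_base hY hα hw hU
    obtain ⟨x, hxB, hxr⟩ := hlp_exists hB (Or.inr rfl)
    rcases hlp_le_of_mem hA (hBU hxB).1 hxr with h | rfl
    · apply hp
      have := hlp_mor_lt hα h
      rwa [hr] at this
    · exact (hBU hxB).2 (hu x ⟨(hBU hxB).1, hxr⟩)

theorem hlp_consol_trim {SQ : POSystem Q} {SP : POSystem P} {Y : Q → Set W} {α : Q → P}
    [T2Space W] (hY : IsTrimPartition SQ Y) (hα : IsMorphism SQ SP α)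
    (hs : Function.Surjective α) : IsTrimPartition SP (consol SQ SP Y α) := by
  refine ⟨⟨?_, ?_, ?_⟩, ?_, ?_, ?_⟩
  · intro p
    obtain ⟨q, rfl⟩ := hs p
    obtain ⟨w, hw⟩ := hY.1.1 q
    exact ⟨w, hlp_consol_sub hY hα hw⟩
  · intro p r hne
    exact Set.disjoint_left.2 fun w h1 h2 => hne (hlp_consol_disj h1 h2)
  · intro p
    ext w
    constructor
    · rintro ⟨hl, hw⟩
      obtain ⟨r, hw⟩ := mem_iUnion.1 hw
      refine mem_iUnion₂.2 ⟨r, ?_, hw⟩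
      obtain ⟨q, A, hA, hwA, -, rfl⟩ := hlp_consol_base hY hα hw univ_mem
      obtain ⟨x, hxA, hxp, hxw⟩ := hlp_mem_limit.1 hl A (hlp_nhds hA hwA)
      have hA' := hlp_trim_consol hY hα hA
      rcases hlp_le_of_mem hA' hxA hxp with h | rfl
      · exact h
      · by_contra hn
        exact hxw ((hA'.2.2.2 hn).unique ⟨hxA, hxp⟩ ⟨hwA, hw⟩)
    · intro h
      obtain ⟨r, hr, hw⟩ := mem_iUnion₂.1 h
      refine ⟨hlp_mem_limit.2 ?_, mem_iUnion.2 ⟨r, hw⟩⟩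
      intro U hU
      by_cases hex : ∃ s, w ∈ Y s
      · obtain ⟨s, hs'⟩ := hex
        obtain rfl := hlp_consol_disj hw (hlp_consol_sub hY hα hs')
        obtain ⟨t, ht, rfl⟩ := hlp_mor_ex hα hr
        obtain ⟨x, hxU, hxt, hxw⟩ := hlp_mem_limit.1 ((hlp_limit hY hs').2 ht) U hU
        exact ⟨x, hxU, hlp_consol_sub hY hα hxt, hxw⟩
      · obtain ⟨q, A, hA, hwA, hAU, rfl⟩ := hlp_consol_base hY hα hw hU
        obtain ⟨t, ht, rfl⟩ := hlp_mor_ex hα hr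
        obtain ⟨x, hxA, hxt⟩ := hlp_exists hA (Or.inl ht)
        refine ⟨x, hAU hxA, hlp_consol_sub hY hα hxt, ?_⟩
        rintro rfl
        exact hex ⟨t, hxt⟩
  · intro w U hU
    obtain ⟨A, ⟨q, hA⟩, hwA, hAU⟩ := hY.2.1 w U hU
    exact ⟨A, ⟨α q, hlp_trim_consol hY hα hA⟩, hwA, hAU⟩
  · intro p _ w hw
    have h1 : ∀ q ∈ Iw SQ Y w, SP.le (α q) p := by
      rintro q ⟨B, hB, hwB⟩
      obtain ⟨C, hC, hwC, hCB⟩ := hw B (hlp_nhds hB hwB)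
      obtain ⟨x, hxC, hxp⟩ := hlp_exists hC (Or.inr rfl)
      exact hlp_le_of_mem (hlp_trim_consol hY hα hB) (hCB hxC) hxp
    refine ⟨?_, h1⟩
    obtain ⟨C, hC, hwC, -⟩ := hw univ univ_mem
    obtain ⟨B, ⟨q, hB⟩, hwB, hBC⟩ := hY.2.1 w C (hlp_nhds hC hwC)
    obtain ⟨x, hxB, hxq⟩ := hlp_exists hB (Or.inr rfl)
    exact ⟨q, ⟨B, hB, hwB⟩, hlp_le_antisymm (h1 q ⟨B, hB, hwB⟩)
      (hlp_le_of_mem hC (hBC hxB) (hlp_consol_sub hY hα hxq))⟩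
  · intro p w hw
    obtain ⟨q, A, hA, hwA, -, rfl⟩ := hlp_consol_base hY hα hw univ_mem
    exact ⟨A, hlp_trim_consol hY hα hA, hwA⟩

theorem hlp_consol_reg {SQ : POSystem Q} {SP : POSystem P} {Y : Q → Set W} {α : Q → P}
    (hY : IsTrimPartition SQ Y) (hα : IsMorphism SQ SP α) :
    RegRefines SQ SP Y (consol SQ SP Y α) α := by
  refine ⟨fun q w hw => hlp_consol_sub hY hα hw, ?_⟩
  intro p _ A hA
  obtain ⟨w, hwA, hw⟩ := hlp_exists hA (Or.inr rfl)
  obtain ⟨q, B, hB, hwB, hBA, rfl⟩ := hlp_consol_base hY hα hw (hlp_nhds hA hwA)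
  obtain ⟨x, hxB, hxq⟩ := hlp_exists hB (Or.inr rfl)
  exact ⟨q, ⟨x, hBA hxB, hxq⟩, rfl⟩

theorem hlp_unique {SQ : POSystem Q} {SP : POSystem P} {Y : Q → Set W} {α : Q → P}
    (hY : IsTrimPartition SQ Y) (hα : IsMorphism SQ SP α) {Z : P → Set W}
    (hZ : IsTrimPartition SP Z) (hR : RegRefines SQ SP Y Z α) : Z = consol SQ SP Y α := by
  funext p
  ext w
  constructor
  · intro hw
    have h1 : ∀ q ∈ Iw SQ Y w, SP.le (α q) p := by
      rintro q ⟨B, hB, hwB⟩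
      obtain ⟨C, hC, hwC, hCB⟩ := hlp_base hZ hw (hlp_nhds hB hwB)
      obtain ⟨r, ⟨x, hxC, hxr⟩, rfl⟩ := hR.2 p ⟨C, hC⟩ C hC
      exact hlp_mor_le hα (hlp_le_of_mem hB (hCB hxC) hxr)
    refine ⟨?_, h1⟩
    obtain ⟨C, hC, hwC, -⟩ := hlp_base hZ hw univ_mem
    obtain ⟨B, ⟨q, hB⟩, hwB, hBC⟩ := hY.2.1 w C (hlp_nhds hC hwC)
    obtain ⟨x, hxB, hxq⟩ := hlp_exists hB (Or.inr rfl)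
    exact ⟨q, ⟨B, hB, hwB⟩, hlp_le_antisymm (h1 q ⟨B, hB, hwB⟩)
      (hlp_le_of_mem hC (hBC hxB) (hR.1 q hxq))⟩
  · intro hw
    have hph : p ∈ Phat SP Z := by
      obtain ⟨z, hz⟩ := hZ.1.1 p
      obtain ⟨A, hA, -⟩ := hZ.2.2.2 p z hz
      exact ⟨A, hA⟩
    refine hZ.2.2.1 p hph w ?_
    intro U hU
    obtain ⟨q0, B0, hB0, hwB0, -, h0⟩ := hlp_consol_base hY hα hw univ_mem
    obtain ⟨A, ⟨s, hA⟩, hwA, hAU⟩ := hZ.2.1 w (U ∩ B0) (inter_mem hU (hlp_nhds hB0 hwB0))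
    have h1 : SP.le p s := by
      obtain ⟨r, ⟨x, hxA, hxr⟩, rfl⟩ := hR.2 s ⟨A, hA⟩ A hA
      rw [← h0]
      exact hlp_mor_le hα (hlp_le_of_mem hB0 (hAU hxA).2 hxr)
    obtain ⟨r, B, hB, hwB, hBA, hr⟩ := hlp_consol_base hY hα hw (hlp_nhds hA hwA)
    obtain ⟨x, hxB, hxr⟩ := hlp_exists hB (Or.inr rfl)
    have h2 : SP.le s p := by
      rw [← hr]
      exact hlp_le_of_mem hA (hBA hxB) (hR.1 r hxr)
    obtain rfl := hlp_le_antisymm h1 h2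
    exact ⟨A, hA, hwA, fun x hx => (hAU hx).1⟩

theorem hlp_surj_mor {SQ : POSystem Q} {SP : POSystem P} {Y : Q → Set W} {α : Q → P}
    [T2Space W] (hY : IsTrimPartition SQ Y) {Z : P → Set W}
    (hZ : IsTrimPartition SP Z) (hR : RegRefines SQ SP Y Z α) :
    Function.Surjective α ∧ IsMorphism SQ SP α := by
  constructor
  · intro p
    obtain ⟨z, hz⟩ := hZ.1.1 p
    obtain ⟨A, hA, -⟩ := hZ.2.2.2 p z hz
    obtain ⟨q, -, hq⟩ := hR.2 p ⟨A, hA⟩ A hA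
    exact ⟨q, hq⟩
  · intro q
    obtain ⟨w, hw⟩ := hY.1.1 q
    have hwZ := hR.1 q hw
    ext p
    constructor
    · rintro ⟨r, hr, rfl⟩
      refine (hlp_limit hZ hwZ).1 (hlp_mem_limit.2 fun U hU => ?_)
      obtain ⟨x, hxU, hx, hxw⟩ := hlp_mem_limit.1 ((hlp_limit hY hw).2 hr) U hU
      exact ⟨x, hxU, hR.1 r hx, hxw⟩
    · intro hp
      obtain ⟨A, hA, hwA⟩ := hY.2.2.2 q w hw
      obtain ⟨z, hzA, hz, hzw⟩ :=
        hlp_mem_limit.1 ((hlp_limit hZ hwZ).2 hp) A (hlp_nhds hA hwA)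
      obtain ⟨C, hC, hzC, hCA⟩ := hlp_base hZ hz
        (inter_mem (hlp_nhds hA hzA) (isOpen_compl_singleton.mem_nhds hzw))
      obtain ⟨r, ⟨x, hxC, hxr⟩, rfl⟩ := hR.2 p ⟨C, hC⟩ C hC
      refine ⟨r, ?_, rfl⟩
      rcases hlp_le_of_mem hA (hCA hxC).1 hxr with h | rfl
      · exact h
      · by_contra hn
        exact (hCA hxC).2 ((hA.2.2.2 hn).unique ⟨(hCA hxC).1, hxr⟩ ⟨hwA, hw⟩)

end Helpers

/-- one-to-one correspondence between equivalence classes of `Q`-pairs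
`(P, α)` and trim partitions of `W` regularly consolidating `𝒴`. -/
theorem qPairs_correspondence {W : Type u} {Q : Type v}
    [TopologicalSpace W] [SecondCountableTopology W] [LocallyCompactSpace W]
    [T2Space W] [TotallyDisconnectedSpace W]
    [Countable Q] (SQ : POSystem Q) (Y : Q → Set W)
    (hW : PrimitiveSpace W) (hY : IsTrimPartition SQ Y) :
    -- the assignment `(P, α) ↦ 𝒴α` is well defined: existence and uniqueness
    (∀ (P : Type v) (SP : POSystem P) (α : Q → P), Function.Surjective α →
      POSystem.IsMorphism SQ SP α →
      ∃! Z : P → Set W, IsTrimPartition SP Z ∧ RegRefines SQ SP Y Z α) ∧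
    -- every trim partition regularly consolidating `𝒴` arises from a `Q`-pair
    (∀ (P : Type v) (SP : POSystem P) (α : Q → P) (Z : P → Set W),
      IsTrimPartition SP Z → RegRefines SQ SP Y Z α →
      Function.Surjective α ∧ POSystem.IsMorphism SQ SP α) ∧
    -- the assignment is injective on equivalence classes: two `Q`-pairs are equivalent
    -- iff the corresponding trim partitions agree up to relabelling
    (∀ (P₁ : Type v) (S₁ : POSystem P₁) (α₁ : Q → P₁) (Z₁ : P₁ → Set W)
       (P₂ : Type v) (S₂ : POSystem P₂) (α₂ : Q → P₂) (Z₂ : P₂ → Set W),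
      Function.Surjective α₁ → POSystem.IsMorphism SQ S₁ α₁ →
      Function.Surjective α₂ → POSystem.IsMorphism SQ S₂ α₂ →
      IsTrimPartition S₁ Z₁ → RegRefines SQ S₁ Y Z₁ α₁ →
      IsTrimPartition S₂ Z₂ → RegRefines SQ S₂ Y Z₂ α₂ →
      ((∃ β : P₁ → P₂, POSystem.IsIso S₁ S₂ β ∧ ∀ q, α₂ q = β (α₁ q)) ↔
        (∃ β : P₁ → P₂, POSystem.IsIso S₁ S₂ β ∧ ∀ p, Z₂ (β p) = Z₁ p))) := by
  refine ⟨?_, ?_, ?_⟩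
  · intro P SP α hs hα
    exact ⟨consol SQ SP Y α, ⟨hlp_consol_trim hY hα hs, hlp_consol_reg hY hα⟩,
      fun Z hZ => hlp_unique hY hα hZ.1 hZ.2⟩
  · intro P SP α Z hZ hR
    exact hlp_surj_mor hY hZ hR
  · intro P₁ S₁ α₁ Z₁ P₂ S₂ α₂ Z₂ _ hα₁ _ hα₂ hZ₁ hR₁ hZ₂ hR₂
    constructor
    · rintro ⟨β, hβ, h⟩
      refine ⟨β, hβ, fun p => ?_⟩
      rw [hlp_unique hY hα₁ hZ₁ hR₁, hlp_unique hY hα₂ hZ₂ hR₂]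
      have hle : ∀ a b, S₂.le (β a) (β b) ↔ S₁.le a b := fun a b => by
        unfold POSystem.le
        rw [← hβ.2 a b, hβ.1.1.eq_iff]
      ext w
      simp only [consol, mem_setOf_eq, h, hle, hβ.1.1.eq_iff]
    · rintro ⟨β, hβ, h⟩
      refine ⟨β, hβ, fun q => ?_⟩
      obtain ⟨w, hw⟩ := hY.1.1 q
      have h1 := hR₁.1 q hw
      rw [← h] at h1
      exact hlp_disj hZ₂ (hR₂.1 q hw) h1
end

section
/- Let P be a countable PO system, {Z_p | p ∈ P}* a trim P-partition of the primitive ω-Stone space W, and N a subset of P such that the closure of Z_N = ⋃_{p ∈ N} Z_p is compact. Then N has a finite foundation. -/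
open Set Filter Topology

universe u v

open POSystem

/-- if the closure of `Z_N` is compact then `N` has a finite foundation. -/
theorem finite_foundation_of_compact_closure {P : Type u} {W : Type v}
    [Countable P]
    [TopologicalSpace W] [SecondCountableTopology W] [LocallyCompactSpace W]
    [T2Space W] [TotallyDisconnectedSpace W]
    (SP : POSystem P) (Z : P → Set W)
    (hW : PrimitiveSpace W) (hZ : IsTrimPartition SP Z)
    (N : Set P) (hc : IsCompact (closure (⋃ p ∈ N, Z p))) :
    POSystem.HasFinFoundation SP N := by
  obtain ⟨⟨hne, -, hlim⟩, hT1, -, -⟩ := hZ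
  choose A hA hwA _ using fun w : W => hT1 w Set.univ Filter.univ_mem
  choose t ht using hA
  obtain ⟨s, hsK, hs⟩ := hc.elim_nhds_subcover A
    (fun w _ => (ht w).2.1.mem_nhds (hwA w))
  have hle : ∀ w q, (A w ∩ Z q).Nonempty ↔ SP.le (t w) q := by
    intro w q
    have h := (ht w).2.2.1
    exact Set.ext_iff.1 h q
  refine ⟨t '' (s : Set W), s.finite_toSet.image t, ?_, ?_⟩
  · rintro _ ⟨w, hw, rfl⟩
    obtain ⟨x, hxA, hx⟩ := mem_closure_iff.1 (hsK w hw) (A w) (ht w).2.1 (hwA w)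
    simp only [Set.mem_iUnion] at hx
    obtain ⟨q, hq, hxq⟩ := hx
    exact ⟨q, hq, (hle w q).1 ⟨x, hxA, hxq⟩⟩
  · rintro r ⟨q, hq, hrq⟩
    obtain ⟨x, hx⟩ := hne r
    have hsub : Z q ⊆ ⋃ p ∈ N, Z p := Set.subset_biUnion_of_mem (u := Z) hq
    have hxK : x ∈ closure (⋃ p ∈ N, Z p) := by
      rcases hrq with h | rfl
      · have h1 : x ∈ ⋃ q' ∈ {q' : P | SP.lt q' q}, Z q' := Set.mem_biUnion (t := Z) h hx
        rw [← hlim q] at h1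
        exact closure_mono (Set.diff_subset.trans hsub) h1.1
      · exact subset_closure (hsub hx)
    have hxU := hs hxK
    simp only [Set.mem_iUnion] at hxU
    obtain ⟨w, hw, hxw⟩ := hxU
    exact ⟨t w, ⟨w, hw, rfl⟩, (hle w r).1 ⟨x, hxw, hx⟩⟩
end

section
/- A countable Boolean ring is primitive if and only if it is isomorphic to a direct sum of countable primitive Boolean algebras. -/
universe u

/-- An element `a` of a (generalized) Boolean algebra -- equivalently, of a Boolean ring
possibly without a `1` -- is pseudo-indecomposable (PI) if for every `b ≤ a`, either the
ideal `(b) = {c | c ≤ b}` is isomorphic to `(a)`, or `(a \ b) ≅ (a)`. -/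
def GIsPI {R : Type*} [GeneralizedBooleanAlgebra R] (a : R) : Prop :=
  ∀ b : R, b ≤ a →
    Nonempty ({c : R // c ≤ b} ≃o {c : R // c ≤ a}) ∨
      Nonempty ({c : R // c ≤ a \ b} ≃o {c : R // c ≤ a})

/-- A Boolean ring (formalized as a generalized Boolean algebra) is primitive if every
element is the disjoint union of finitely many PI elements. -/
def GPrimitive (R : Type*) [GeneralizedBooleanAlgebra R] : Prop :=
  ∀ a : R, ∃ l : List R, (∀ b ∈ l, GIsPI b) ∧ l.Pairwise Disjoint ∧
    l.foldr (· ⊔ ·) ⊥ = a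

theorem aux_mem_iff {R : Type*} [GeneralizedBooleanAlgebra R] (l : List R) :
    ∀ b ∈ l, b ≤ l.foldr (· ⊔ ·) ⊥ := by
  induction l with
  | nil => simp
  | cons x t ih =>
    intro b hb
    rcases List.mem_cons.1 hb with rfl | hb
    · exact le_sup_left
    · exact (ih b hb).trans le_sup_right

inductive Dec {R : Type*} [GeneralizedBooleanAlgebra R] : R → Prop
  | bot : Dec ⊥
  | cons (b c : R) (hb : GIsPI b) (hd : Disjoint b c) (hc : Dec c) : Dec (b ⊔ c)

theorem dec_iff {R : Type*} [GeneralizedBooleanAlgebra R] (a : R) :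
    Dec a ↔ ∃ l : List R, (∀ b ∈ l, GIsPI b) ∧ l.Pairwise Disjoint ∧
    l.foldr (· ⊔ ·) ⊥ = a := by
  constructor
  · intro h
    induction h with
    | bot => exact ⟨[], by simp⟩
    | cons b c hb hd hc ih =>
      obtain ⟨l, h1, h2, rfl⟩ := ih
      refine ⟨b :: l, ?_, ?_, rfl⟩
      · intro x hx
        rcases List.mem_cons.1 hx with rfl | hx
        exacts [hb, h1 x hx]
      · exact List.pairwise_cons.2 ⟨fun x hx => hd.mono_right (aux_mem_iff l x hx), h2⟩
  · rintro ⟨l, h1, h2, rfl⟩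
    induction l with
    | nil => exact Dec.bot
    | cons x t ih =>
      rw [List.pairwise_cons] at h2
      refine Dec.cons x _ (h1 x (by simp)) ?_ (ih (fun b hb => h1 b (by simp [hb])) h2.2)
      have h3 := h2.1
      clear ih h1 h2
      induction t with
      | nil => simp
      | cons y s ih =>
        exact Disjoint.sup_right (h3 y (by simp)) (ih (fun z hz => h3 z (by simp [hz])))

theorem Dec.sup {R : Type*} [GeneralizedBooleanAlgebra R] {a b : R} (ha : Dec a) (hb : Dec b)
    (h : Disjoint a b) : Dec (a ⊔ b) := by
  induction ha with
  | bot => simpa using hb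
  | cons x c hx hd hc ih =>
    rw [sup_assoc]
    rw [disjoint_sup_left] at h
    exact Dec.cons x _ hx (Disjoint.sup_right hd h.1) (ih h.2)

def resIso {R S : Type*} [PartialOrder R] [PartialOrder S] {a : R} {a' : S}
    (φ : {c : R // c ≤ a} ≃o {c : S // c ≤ a'}) (b : {c : R // c ≤ a}) :
    {c : R // c ≤ b.1} ≃o {c : S // c ≤ (φ b).1} where
  toFun c := ⟨(φ ⟨c.1, c.2.trans b.2⟩).1, φ.monotone (show (⟨c.1, _⟩ : {c : R // c ≤ a}) ≤ b from c.2)⟩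
  invFun c := ⟨(φ.symm ⟨c.1, c.2.trans (φ b).2⟩).1, by
    have : φ.symm ⟨c.1, c.2.trans (φ b).2⟩ ≤ b := by
      rw [φ.symm_apply_le]; exact c.2
    exact this⟩
  left_inv c := by simp
  right_inv c := by simp
  map_rel_iff' {c d} := by
    show φ _ ≤ φ _ ↔ _
    rw [φ.le_iff_le]; rfl

theorem iso_sup {R S : Type*} [GeneralizedBooleanAlgebra R] [GeneralizedBooleanAlgebra S]
    {a : R} {a' : S} (φ : {c : R // c ≤ a} ≃o {c : S // c ≤ a'}) (b c : R) (hb : b ≤ a)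
    (hc : c ≤ a) (h : b ⊔ c = a) : (φ ⟨b, hb⟩).1 ⊔ (φ ⟨c, hc⟩).1 = a' := by
  apply le_antisymm (sup_le (φ _).2 (φ _).2)
  set u : {c : S // c ≤ a'} := ⟨(φ ⟨b, hb⟩).1 ⊔ (φ ⟨c, hc⟩).1, sup_le (φ _).2 (φ _).2⟩ with hu
  have h1 : φ ⟨b, hb⟩ ≤ u := show (φ ⟨b, hb⟩).1 ≤ u.1 from le_sup_left
  have h2 : φ ⟨c, hc⟩ ≤ u := show (φ ⟨c, hc⟩).1 ≤ u.1 from le_sup_right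
  rw [← φ.le_symm_apply] at h1 h2
  have h3 : (⟨a, le_rfl⟩ : {c : R // c ≤ a}) ≤ φ.symm u := by
    show a ≤ (φ.symm u).1
    exact h.symm.le.trans (sup_le h1 h2)
  rw [φ.le_symm_apply] at h3
  have h4 : (⟨a', le_rfl⟩ : {c : S // c ≤ a'}) ≤ φ ⟨a, le_rfl⟩ := by
    rw [← φ.symm_apply_le]; exact (φ.symm _).2
  exact h4.trans h3

theorem iso_disj {R S : Type*} [GeneralizedBooleanAlgebra R] [GeneralizedBooleanAlgebra S]
    {a : R} {a' : S} (φ : {c : R // c ≤ a} ≃o {c : S // c ≤ a'}) (b c : R) (hb : b ≤ a)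
    (hc : c ≤ a) (h : Disjoint b c) : Disjoint (φ ⟨b, hb⟩).1 (φ ⟨c, hc⟩).1 := by
  intro x hx hy
  have hxa : x ≤ a' := hx.trans (φ _).2
  have h1 : (⟨x, hxa⟩ : {c : S // c ≤ a'}) ≤ φ ⟨b, hb⟩ := hx
  have h2 : (⟨x, hxa⟩ : {c : S // c ≤ a'}) ≤ φ ⟨c, hc⟩ := hy
  rw [← φ.symm_apply_le] at h1 h2
  have h3 : (φ.symm ⟨x, hxa⟩).1 ≤ ⊥ := h h1 h2
  have h4 : φ.symm ⟨x, hxa⟩ ≤ φ.symm ⟨⊥, bot_le⟩ := h3.trans bot_le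
  rw [φ.symm.le_iff_le] at h4
  exact h4

theorem GIsPI.transfer {R S : Type*} [GeneralizedBooleanAlgebra R] [GeneralizedBooleanAlgebra S]
    {a : R} {a' : S} (φ : {c : R // c ≤ a} ≃o {c : S // c ≤ a'}) (h : GIsPI a) : GIsPI a' := by
  intro b' hb'
  obtain ⟨⟨b, hb⟩, hφ⟩ := φ.surjective ⟨b', hb'⟩
  have e1 : (φ ⟨b, hb⟩).1 = b' := by rw [hφ]
  have e2 : (φ ⟨a \ b, sdiff_le⟩).1 = a' \ b' := by
    have hs := iso_sup φ b (a \ b) hb sdiff_le (sup_sdiff_cancel_right hb)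
    have hd := iso_disj φ b (a \ b) hb sdiff_le disjoint_sdiff_self_right
    rw [e1] at hs hd
    have h5 := congrArg (· \ b') hs
    simp only [sup_sdiff_left_self, hd.symm.sdiff_eq_left] at h5
    exact h5
  have i1 := resIso φ ⟨b, hb⟩
  have i2 := resIso φ ⟨a \ b, sdiff_le⟩
  rw [e1] at i1
  rw [e2] at i2
  rcases h b hb with k | k <;> obtain ⟨k⟩ := k
  · exact Or.inl ⟨i1.symm.trans (k.trans φ)⟩
  · exact Or.inr ⟨i2.symm.trans (k.trans φ)⟩

theorem Dec.transfer {R S : Type*} [GeneralizedBooleanAlgebra R] [GeneralizedBooleanAlgebra S]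
    {a : R} (h : Dec a) :
    ∀ {a' : S} (_ : {c : R // c ≤ a} ≃o {c : S // c ≤ a'}), Dec a' := by
  induction h with
  | bot =>
    intro a' φ
    have := iso_sup φ ⊥ ⊥ le_rfl le_rfl (by simp)
    have h2 := iso_disj φ ⊥ ⊥ le_rfl le_rfl (by simp)
    rw [disjoint_self] at h2
    rw [h2] at this
    simp at this
    rw [← this]; exact Dec.bot
  | cons b c hb hd hc ih =>
    intro a' φ
    rw [← iso_sup φ b c le_sup_left le_sup_right rfl]
    exact Dec.cons _ _ (hb.transfer (resIso φ ⟨b, le_sup_left⟩))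
      (iso_disj φ b c le_sup_left le_sup_right hd) (ih (resIso φ ⟨c, le_sup_right⟩))

def singleIso {ι : Type*} [DecidableEq ι] {B : ι → Type*} [∀ i, BooleanAlgebra (B i)] (i : ι)
    (b : B i) : {c : B i // c ≤ b} ≃o
      {c : ∀ i, B i // c ≤ Function.update (⊥ : ∀ i, B i) i b} where
  toFun c := ⟨Function.update ⊥ i c.1, by
    exact update_le_update_iff.2 ⟨c.2, fun _ _ => le_rfl⟩⟩
  invFun c := ⟨c.1 i, by simpa using c.2 i⟩
  left_inv c := by simp
  right_inv c := by
    ext j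
    by_cases h : j = i
    · subst h; simp
    · have := c.2 j
      simp [h] at this
      simp [h, this]
  map_rel_iff' {c d} := by
    refine (update_le_update_iff (x := (⊥ : ∀ i, B i)) (y := ⊥)).trans ?_
    exact ⟨fun h => h.1, fun h => ⟨h, fun _ _ => le_rfl⟩⟩

theorem dec_pi {ι : Type*} {B : ι → Type*} [∀ i, BooleanAlgebra (B i)]
    (h : ∀ i (b : B i), Dec b) (s : Finset ι) :
    ∀ x : ∀ i, B i, (∀ i, x i ≠ ⊥ → i ∈ s) → Dec x := by
  classical
  induction s using Finset.induction_on with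
  | empty =>
    intro x hx
    have : x = ⊥ := by
      ext i
      by_contra hi
      simpa using hx i hi
    rw [this]; exact Dec.bot
  | insert i s hi ih =>
    intro x hx
    have e : x = Function.update x i ⊥ ⊔ Function.update ⊥ i (x i) := by
      ext j
      by_cases hj : j = i
      · subst hj; simp
      · simp [hj]
    rw [e]
    apply Dec.sup
    · apply ih
      intro j hj
      by_cases hji : j = i
      · subst hji; simp at hj
      · rw [Function.update_of_ne hji] at hj
        simpa [hji] using hx j hj
    · exact (h i (x i)).transfer (singleIso i (x i))
    · rw [Pi.disjoint_iff]
      intro j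
      by_cases hj : j = i
      · subst hj; simp
      · simp [hj]

@[reducible] def iicBA {R : Type*} [GeneralizedBooleanAlgebra R] (d : R) :
    BooleanAlgebra (Set.Iic d) where
  sup x y := ⟨x.1 ⊔ y.1, sup_le x.2 y.2⟩
  inf x y := ⟨x.1 ⊓ y.1, inf_le_left.trans x.2⟩
  le_sup_left _ _ := le_sup_left (α := R)
  le_sup_right _ _ := le_sup_right (α := R)
  sup_le _ _ _ h1 h2 := sup_le (α := R) h1 h2
  inf_le_left _ _ := inf_le_left (α := R)
  inf_le_right _ _ := inf_le_right (α := R)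
  le_inf _ _ _ h1 h2 := le_inf (α := R) h1 h2
  le_sup_inf _ _ _ := le_sup_inf (α := R)
  top := ⟨d, le_rfl⟩
  bot := ⟨⊥, bot_le⟩
  le_top x := x.2
  bot_le x := bot_le (α := R)
  compl x := ⟨d \ x.1, sdiff_le⟩
  inf_compl_le_bot x := (disjoint_sdiff_self_right (α := R)).le_bot
  top_le_sup_compl x := (sup_sdiff_cancel_right (α := R) x.2).ge

def iicIso {R : Type*} [PartialOrder R] (d : R) (x : Set.Iic d) :
    {c : R // c ≤ x.1} ≃o {c : Set.Iic d // c ≤ x} where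
  toFun c := ⟨⟨c.1, c.2.trans x.2⟩, c.2⟩
  invFun c := ⟨c.1.1, c.2⟩
  left_inv c := rfl
  right_inv c := rfl
  map_rel_iff' := Iff.rfl

theorem exists_iso {R : Type u} [GeneralizedBooleanAlgebra R] (d : ℕ → R)
    (hd : Pairwise (Function.onFun Disjoint d))
    (hc : ∀ r : R, ∃ n, r ≤ (Finset.range n).sup d) :
    Nonempty (R ≃o {x : ∀ i : ULift.{u} ℕ, Set.Iic (d i.down) //
      {i | (x i).1 ≠ ⊥}.Finite}) := by
  let F : R → {x : ∀ i : ULift.{u} ℕ, Set.Iic (d i.down) // {i | (x i).1 ≠ ⊥}.Finite} := fun r =>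
    ⟨fun i => ⟨r ⊓ d i.down, inf_le_right⟩, by
      obtain ⟨n, hn⟩ := hc r
      apply ((Set.finite_lt_nat n).preimage (ULift.down_injective.injOn)).subset
      intro i hi
      by_contra hin
      apply hi
      have : Disjoint r (d i.down) := by
        refine Disjoint.mono_left hn ?_
        rw [Finset.disjoint_sup_left]
        intro j hj
        apply hd
        simp at hin hj
        omega
      exact this.eq_bot⟩
  have hF : ∀ r s, F r ≤ F s ↔ r ≤ s := by
    intro r s
    constructor
    · intro h
      obtain ⟨n, hn⟩ := hc r
      rw [← inf_eq_left.2 hn, Finset.sup_inf_distrib_left]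
      apply Finset.sup_le
      intro j _
      have : r ⊓ d j ≤ s ⊓ d j := h ⟨j⟩
      exact this.trans inf_le_left
    · intro h i
      exact inf_le_inf_right (d i.down) h
  have hs : Function.Surjective F := by
    rintro ⟨x, hx⟩
    refine ⟨hx.toFinset.sup (fun i => (x i).1), ?_⟩
    apply Subtype.ext
    funext i
    apply Subtype.ext
    show hx.toFinset.sup (fun i => (x i).1) ⊓ d i.down = (x i).1
    apply le_antisymm
    · rw [Finset.sup_inf_distrib_right]
      apply Finset.sup_le
      intro j _
      by_cases hj : j = i
      · subst hj; exact inf_le_left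
      · have : Disjoint (x j).1 (d i.down) :=
          (hd (fun h => hj (ULift.down_injective h))).mono_left (x j).2
        rw [this.eq_bot]; exact bot_le
    · refine le_inf ?_ (x i).2
      by_cases hi : (x i).1 = ⊥
      · rw [hi]; exact bot_le
      · exact Finset.le_sup (f := fun i => (x i).1) (by simpa using hi)
  exact ⟨RelIso.ofSurjective (OrderEmbedding.ofMapLEIff F hF) hs⟩

/-- a countable Boolean ring is primitive iff it is isomorphic to a
direct sum of countable primitive Boolean algebras (the direct sum being the subring of
the product consisting of elements with all but finitely many coordinates `⊥`). -/
theorem primitive_iff_directSum_of_primitive_BAs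
    (R : Type u) [GeneralizedBooleanAlgebra R] [Countable R] :
    GPrimitive R ↔
      ∃ (ι : Type u) (B : ι → Type u) (inst : ∀ i, BooleanAlgebra (B i)),
        Countable ι ∧
        (letI := inst
         (∀ i, Countable (B i)) ∧ (∀ i, GPrimitive (B i)) ∧
          Nonempty (R ≃o {x : ∀ i, B i // {i | x i ≠ ⊥}.Finite})) := by
  constructor
  · intro h
    obtain ⟨f, hf⟩ := exists_surjective_nat R
    refine ⟨ULift.{u} ℕ, fun i => Set.Iic (disjointed f i.down), fun i => iicBA _,
      inferInstance, fun i => Subtype.countable, ?_, ?_⟩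
    · intro i a
      letI := iicBA (disjointed f i.down)
      rw [← dec_iff]
      exact ((dec_iff a.1).2 (h a.1)).transfer (iicIso _ a)
    · obtain ⟨e⟩ := exists_iso (disjointed f) (disjoint_disjointed f) (by
        intro r
        obtain ⟨n, rfl⟩ := hf r
        refine ⟨n + 1, ?_⟩
        rw [← partialSups_eq_sup_range, partialSups_disjointed]
        exact le_partialSups f n)
      have key : ∀ x : ∀ i : ULift.{u} ℕ, Set.Iic (disjointed f i.down),
          {i | (x i).1 ≠ ⊥} = {i | x i ≠ (iicBA (disjointed f i.down)).bot} := by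
        intro x; ext i
        exact not_congr ⟨fun h => Subtype.ext h, fun h => congrArg Subtype.val h⟩
      exact ⟨e.trans
        { toFun := fun x => ⟨x.1, key x.1 ▸ x.2⟩
          invFun := fun x => ⟨x.1, (key x.1).symm ▸ x.2⟩
          left_inv := fun _ => rfl
          right_inv := fun _ => rfl
          map_rel_iff' := Iff.rfl }⟩
  · rintro ⟨ι, B, inst, -, -, h, ⟨e⟩⟩ a
    rw [← dec_iff]
    have h1 : Dec (e a).1 := dec_pi (fun i b => (dec_iff b).2 (h i b)) (e a).2.toFinset _
      (fun i hi => by simpa using hi)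
    refine h1.transfer (OrderIso.symm ?_)
    exact
      { toFun := fun c => ⟨(e c.1).1, e.monotone c.2⟩
        invFun := fun c => ⟨e.symm ⟨c.1, (e a).2.subset (fun i hi h0 => hi (le_bot_iff.1 (h0 ▸ c.2 i)))⟩, by
          rw [e.symm_apply_le]; exact c.2⟩
        left_inv := fun c => by simp
        right_inv := fun c => by simp
        map_rel_iff' := fun {c d} => e.le_iff_le }
end
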